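/- Let ρ = (1/2)(|00⟩⟨00| + |+1⟩⟨+1|), and let Π'_± = (1/2)(I₂ ± (σ₁−σ₃)/√2) be the projectors onto the eigenbasis of the observable (σ₁−σ₃)/√2. Then Tr[ρ(Π'_±⊗I₂)] = 1/2 and Tr_A[ρ(Π'_±⊗I₂)] = (1/2)·(1/2)(I₂ ∓ (1/√2)σ₃); i.e., each outcome occurs with probability 1/2 and Bob's normalized conditional states are (1/2)(I₂ ∓ (1/√2)σ₃). Consequently, with S(ρ) = −Σ_μ μ log₂ μ over eigenvalues and h the binary entropy, the Holevo quantity of this ensemble equals S(I₂/2) − (1/2)S(ρ_{B|+}) − (1/2)S(ρ_{B|−}) = 1 − h((1+1/√2)/2). -/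

import Mathlib

open Matrix
open scoped Kronecker

noncomputable section

/-- Pauli matrices. -/
def σ1 : Matrix (Fin 2) (Fin 2) ℂ := !![0, 1; 1, 0]
def σ2 : Matrix (Fin 2) (Fin 2) ℂ := !![0, -Complex.I; Complex.I, 0]
def σ3 : Matrix (Fin 2) (Fin 2) ℂ := !![1, 0; 0, -1]

/-- The 2×2 identity. -/
def I₂ : Matrix (Fin 2) (Fin 2) ℂ := 1

/-- Partial trace over the first qubit: `(Tr_A N)_{j,j'} = Σᵢ N_{(i,j),(i,j')}`. -/
def trA (N : Matrix (Fin 2 × Fin 2) (Fin 2 × Fin 2) ℂ) : Matrix (Fin 2) (Fin 2) ℂ :=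
  fun j j' => ∑ i : Fin 2, N (i, j) (i, j')

/-- The rank-one projector `|v⟩⟨v|` on a qubit. -/
def proj2 (v : Fin 2 → ℂ) : Matrix (Fin 2) (Fin 2) ℂ := Matrix.vecMulVec v (star v)

/-- `|0⟩`, `|1⟩`, `|+⟩ = (|0⟩+|1⟩)/√2`. -/
def ket0 : Fin 2 → ℂ := ![1, 0]
def ket1 : Fin 2 → ℂ := ![0, 1]
def ketPlus : Fin 2 → ℂ := ![((1 / Real.sqrt 2 : ℝ) : ℂ), ((1 / Real.sqrt 2 : ℝ) : ℂ)]

/-- The binary entropy function. -/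
def binEnt (x : ℝ) : ℝ := -(x * Real.logb 2 x) - (1 - x) * Real.logb 2 (1 - x)

open Classical in
/-- The von Neumann entropy `S(ρ) = −Σ_μ μ log₂ μ` over the eigenvalues of `ρ`
(defined for Hermitian `ρ`; junk value `0` otherwise). -/
def vnEntropy (ρ : Matrix (Fin 2) (Fin 2) ℂ) : ℝ :=
  if h : ρ.IsHermitian then
    -(∑ j, h.eigenvalues j * Real.logb 2 (h.eigenvalues j))
  else 0

/-- The von Neumann entropy of a real diagonal matrix is the Shannon entropy of its diagonal. -/
theorem vnEntropy_diagonal (d : Fin 2 → ℝ) :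
    vnEntropy (diagonal fun i => (d i : ℂ)) = -∑ i, d i * Real.logb 2 (d i) := by
  have h : (diagonal fun i => (d i : ℂ)).IsHermitian := by
    rw [isHermitian_diagonal_iff]
    intro i
    simp [isSelfAdjoint_iff]
  have hroots := h.roots_charpoly_eq_eigenvalues
  rw [charpoly_diagonal, Polynomial.roots_prod _ _ (Finset.prod_ne_zero_iff.mpr fun i _ =>
    Polynomial.X_sub_C_ne_zero _)] at hroots
  have hmap : Finset.univ.val.map d = Finset.univ.val.map h.eigenvalues := by
    simpa [Function.comp_def] using congrArg (Multiset.map Complex.re) hroots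
  have hsum := congrArg (fun s => (s.map fun x => x * Real.logb 2 x).sum) hmap
  simp only [Multiset.map_map, Function.comp_def, Finset.sum_map_val] at hsum
  rw [vnEntropy, dif_pos h, hsum]

/-- The von Neumann entropy of the qubit state with Bloch vector along the third axis. -/
theorem vnEntropy_bloch_third (c : ℝ) :
    vnEntropy ((1 / 2 : ℂ) • (I₂ - (c : ℂ) • σ3)) = binEnt ((1 + c) / 2) := by
  have h : (1 / 2 : ℂ) • (I₂ - (c : ℂ) • σ3) =
      diagonal fun i => ((![(1 - c) / 2, (1 + c) / 2] i : ℝ) : ℂ) := by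
    ext i j
    fin_cases i <;> fin_cases j <;> simp [I₂, σ3] <;> ring
  rw [h, vnEntropy_diagonal, binEnt, show 1 - (1 + c) / 2 = (1 - c) / 2 by ring]
  simp only [Fin.sum_univ_two, cons_val_zero, cons_val_one]
  ring

theorem binEnt_one_sub (x : ℝ) : binEnt (1 - x) = binEnt x := by
  simp only [binEnt, sub_sub_cancel]
  ring

theorem binEnt_half : binEnt (1 / 2) = 1 := by
  have h : Real.logb 2 (1 / 2) = -1 := by
    rw [one_div, Real.logb_inv, Real.logb_self_eq_one one_lt_two]
  rw [binEnt, show (1 : ℝ) - 1 / 2 = 1 / 2 by norm_num, h]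
  norm_num

theorem proj2_ket0 : proj2 ket0 = !![1, 0; 0, 0] := by
  ext i j
  fin_cases i <;> fin_cases j <;> simp [proj2, ket0, vecMulVec]

theorem proj2_ket1 : proj2 ket1 = !![0, 0; 0, 1] := by
  ext i j
  fin_cases i <;> fin_cases j <;> simp [proj2, ket1, vecMulVec]

theorem proj2_ketPlus : proj2 ketPlus = !![1 / 2, 1 / 2; 1 / 2, 1 / 2] := by
  have h : ((Real.sqrt 2 : ℝ) : ℂ)⁻¹ * ((Real.sqrt 2 : ℝ) : ℂ)⁻¹ = 1 / 2 := by
    rw [← mul_inv, ← Complex.ofReal_mul, Real.mul_self_sqrt zero_le_two]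
    norm_num
  ext i j
  fin_cases i <;> fin_cases j <;> simpa [proj2, ketPlus, vecMulVec] using h

/-- The trace is preserved by the partial trace. -/
theorem trace_trA (N : Matrix (Fin 2 × Fin 2) (Fin 2 × Fin 2) ℂ) : (trA N).trace = N.trace := by
  simp only [Matrix.trace, trA, diag_apply, Fintype.sum_prod_type]
  exact Finset.sum_comm

/-- The partial trace over the first factor of a product matrix. -/
theorem trA_kronecker (A B : Matrix (Fin 2) (Fin 2) ℂ) : trA (A ⊗ₖ B) = A.trace • B := by
  ext i j
  simp [trA, Matrix.trace, kroneckerMap_apply, add_mul]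

theorem trA_add (M N : Matrix (Fin 2 × Fin 2) (Fin 2 × Fin 2) ℂ) :
    trA (M + N) = trA M + trA N := by
  ext i j
  simp [trA, Finset.sum_add_distrib]

theorem trA_smul (c : ℂ) (N : Matrix (Fin 2 × Fin 2) (Fin 2 × Fin 2) ℂ) :
    trA (c • N) = c • trA N := by
  ext i j
  simp [trA, mul_add]

/-- For `ρ = (1/2)(|00⟩⟨00| + |+1⟩⟨+1|)` and the projectors
`Π'_± = (1/2)(I₂ ± (σ₁−σ₃)/√2)` (sign `ε = ±1`):
`Tr[ρ(Π'_±⊗I₂)] = 1/2` and `Tr_A[ρ(Π'_±⊗I₂)] = (1/2)·(1/2)(I₂ ∓ (1/√2)σ₃)`,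
so each outcome occurs with probability `1/2` and Bob's normalized conditional
states are `(1/2)(I₂ ∓ (1/√2)σ₃)`. Consequently the Holevo quantity of this
ensemble equals `S(I₂/2) − (1/2)S(ρ_{B|+}) − (1/2)S(ρ_{B|−}) = 1 − h((1+1/√2)/2)`. -/
theorem stmt_16 :
    let ρ := (1/2 : ℂ) • (proj2 ket0 ⊗ₖ proj2 ket0 + proj2 ketPlus ⊗ₖ proj2 ket1)
    let Pmeas : ℝ → Matrix (Fin 2) (Fin 2) ℂ := fun ε =>
      (1/2 : ℂ) • (I₂ + (ε : ℂ) • (((Real.sqrt 2 : ℝ) : ℂ)⁻¹ • (σ1 - σ3)))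
    let ρcond : ℝ → Matrix (Fin 2) (Fin 2) ℂ := fun ε =>
      (1/2 : ℂ) • (I₂ - ((ε / Real.sqrt 2 : ℝ) : ℂ) • σ3)
    (∀ ε : ℝ, ε = 1 ∨ ε = -1 →
      (ρ * (Pmeas ε ⊗ₖ I₂)).trace = 1/2 ∧
      trA (ρ * (Pmeas ε ⊗ₖ I₂)) = (1/2 : ℂ) • ρcond ε) ∧
    vnEntropy ((1/2 : ℂ) • I₂) - (1/2) * vnEntropy (ρcond 1)
        - (1/2) * vnEntropy (ρcond (-1)) =
      1 - binEnt ((1 + 1 / Real.sqrt 2) / 2) := by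
  intro ρ Pmeas ρcond
  have htrA (ε : ℝ) : trA (ρ * (Pmeas ε ⊗ₖ I₂)) = (1 / 2 : ℂ) • ρcond ε := by
    have h0 : (proj2 ket0 * Pmeas ε).trace = (1 / 2 : ℂ) * (1 - ε * ((Real.sqrt 2 : ℝ) : ℂ)⁻¹) := by
      simp [Pmeas, proj2_ket0, I₂, one_fin_two, σ1, σ3, trace_fin_two]
      ring
    have hplus : (proj2 ketPlus * Pmeas ε).trace =
        (1 / 2 : ℂ) * (1 + ε * ((Real.sqrt 2 : ℝ) : ℂ)⁻¹) := by
      simp [Pmeas, proj2_ketPlus, I₂, one_fin_two, σ1, σ3, trace_fin_two]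
      ring
    simp only [ρ, smul_mul, add_mul, ← mul_kronecker_mul, trA_smul, trA_add, trA_kronecker,
      h0, hplus, I₂, mul_one]
    ext i j
    fin_cases i <;> fin_cases j <;>
      simp [ρcond, proj2_ket0, proj2_ket1, I₂, σ3] <;> ring
  refine ⟨fun ε _ => ⟨?_, htrA ε⟩, ?_⟩
  · rw [← trace_trA, htrA]
    simp [ρcond, I₂, σ3, Matrix.trace, Fin.sum_univ_two]
    ring
  · have hmix : vnEntropy ((1 / 2 : ℂ) • I₂) = 1 := by
      rw [← binEnt_half]
      simpa using vnEntropy_bloch_third 0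
    have hneg : binEnt ((1 + -1 / Real.sqrt 2) / 2) = binEnt ((1 + 1 / Real.sqrt 2) / 2) := by
      rw [← binEnt_one_sub]
      congr 1
      ring
    rw [hmix, vnEntropy_bloch_third, vnEntropy_bloch_third, hneg]
    ring

end
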